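/- arXiv:2603.26338 — 4 statements merged into one kernel-verified Lean document; each statement's English description precedes it below -/
import Mathlib

section
/- Let F, G ∈ ℂ[u,v] be homogeneous polynomials of degree 2 that are linearly independent over ℂ and have no common zero in ℂ² ∖ {(0,0)}. Then for every (u₀,v₀) ∈ ℂ² ∖ {(0,0)}, the binary quadratic form Q := G(u₀,v₀)·F − F(u₀,v₀)·G is a nonzero scalar multiple of (v₀u − u₀v)² if and only if J(F,G)(u₀,v₀) = 0. (Geometrically: the fixed points of the involution of ℙ¹ attached to the pencil spanned by F and G are exactly the zeros of the Jacobian J(F,G).) -/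
open MvPolynomial

/-- The Jacobian `J(F,G) = F_u G_v - F_v G_u` of two binary forms. -/
noncomputable def jacob (F G : MvPolynomial (Fin 2) ℂ) : MvPolynomial (Fin 2) ℂ :=
  pderiv 0 F * pderiv 1 G - pderiv 1 F * pderiv 0 G

/-- A binary quadratic form is given by its three coefficients. -/
lemma MvPolynomial.IsHomogeneous.exists_eq_binary_quadratic {R : Type*} [CommSemiring R]
    {F : MvPolynomial (Fin 2) R} (hF : F.IsHomogeneous 2) :
    ∃ a b c : R, F = C a * X 0 ^ 2 + C b * (X 0 * X 1) + C c * X 1 ^ 2 := by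
  refine ⟨coeff (Finsupp.single 0 2) F, coeff (Finsupp.single 0 1 + Finsupp.single 1 1) F,
    coeff (Finsupp.single 1 2) F, ?_⟩
  have h2 : (X 0 * X 1 : MvPolynomial (Fin 2) R)
      = monomial (Finsupp.single 0 1 + Finsupp.single 1 1) 1 := by
    simp [X, monomial_mul]
  rw [h2, X_pow_eq_monomial, X_pow_eq_monomial]
  simp only [C_mul_monomial, mul_one]
  ext m
  simp only [coeff_add, coeff_monomial]
  by_cases hm : m 0 + m 1 = 2
  · have hcases : m = Finsupp.single 0 2 ∨ m = Finsupp.single 0 1 + Finsupp.single 1 1 ∨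
        m = Finsupp.single 1 2 := by
      have : m 0 = 2 ∧ m 1 = 0 ∨ m 0 = 1 ∧ m 1 = 1 ∨ m 0 = 0 ∧ m 1 = 2 := by omega
      refine this.imp ?_ (Or.imp ?_ ?_) <;>
      · rintro ⟨h0, h1⟩
        ext i
        fin_cases i <;> simp [h0, h1]
    rcases hcases with rfl | rfl | rfl <;> simp [Finsupp.ext_iff, Fin.forall_fin_two]
  · have hc : coeff m F = 0 := by
      apply hF.coeff_eq_zero
      rwa [Finsupp.degree_eq_sum, Fin.sum_univ_two]
    rw [hc, if_neg, if_neg, if_neg] <;> first | simp | (rintro rfl; simp at hm)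

/-- Let `F, G` be linearly independent binary quadratic forms with no common zero away
from the origin. For a point `(u₀,v₀) ≠ (0,0)`, the quadratic form
`G(u₀,v₀)·F - F(u₀,v₀)·G` is a nonzero scalar multiple of `(v₀u - u₀v)²` iff
`J(F,G)(u₀,v₀) = 0`. -/
theorem stmt6 (F G : MvPolynomial (Fin 2) ℂ)
    (hF : F.IsHomogeneous 2) (hG : G.IsHomogeneous 2)
    (hind : LinearIndependent ℂ ![F, G])
    (hnz : ∀ p : Fin 2 → ℂ, p ≠ 0 → eval p F ≠ 0 ∨ eval p G ≠ 0)
    (u₀ v₀ : ℂ) (hp : ¬(u₀ = 0 ∧ v₀ = 0)) :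
    (∃ c : ℂ, c ≠ 0 ∧
      C (eval ![u₀, v₀] G) * F - C (eval ![u₀, v₀] F) * G
        = C c * (C v₀ * X 0 - C u₀ * X 1) ^ 2) ↔
    eval ![u₀, v₀] (jacob F G) = 0 := by
  have hpt := hnz ![u₀, v₀] (fun h => hp ⟨congrFun h 0, congrFun h 1⟩)
  constructor
  · rintro ⟨k, -, h⟩
    have h0 := congrArg (fun P => eval ![u₀, v₀] (pderiv 0 P)) h
    have h1 := congrArg (fun P => eval ![u₀, v₀] (pderiv 1 P)) h
    simp [pderiv_X, Derivation.leibniz_pow, mul_comm u₀ v₀] at h0 h1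
    simp only [jacob, map_sub, map_mul]
    rcases hpt with hne | hne <;> refine (mul_eq_zero.1 ?_).resolve_left hne
    · linear_combination eval ![u₀, v₀] (pderiv 1 F) * h0 - eval ![u₀, v₀] (pderiv 0 F) * h1
    · linear_combination eval ![u₀, v₀] (pderiv 1 G) * h0 - eval ![u₀, v₀] (pderiv 0 G) * h1
  · intro hJ
    have hQ0 : C (eval ![u₀, v₀] G) * F - C (eval ![u₀, v₀] F) * G ≠ 0 := by
      intro h
      have := LinearIndependent.pair_iff.1 hind (eval ![u₀, v₀] G) (-eval ![u₀, v₀] F)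
        (by rw [smul_eq_C_mul, smul_eq_C_mul, map_neg, neg_mul, ← sub_eq_add_neg, h])
      rcases hpt with hne | hne
      · exact hne (neg_eq_zero.1 this.2)
      · exact hne this.1
    suffices ∃ k : ℂ, C (eval ![u₀, v₀] G) * F - C (eval ![u₀, v₀] F) * G
        = C k * (C v₀ * X 0 - C u₀ * X 1) ^ 2 by
      obtain ⟨k, hk⟩ := this
      refine ⟨k, ?_, hk⟩
      rintro rfl
      exact hQ0 (by rw [hk, C_0, zero_mul])
    obtain ⟨a, b, c, rfl⟩ := hF.exists_eq_binary_quadratic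
    obtain ⟨d, e, f, rfl⟩ := hG.exists_eq_binary_quadratic
    simp [jacob, pderiv_X, Derivation.leibniz_pow] at hJ
    set s := eval ![u₀, v₀] (C d * X 0 ^ 2 + C e * (X 0 * X 1) + C f * X 1 ^ 2) with hs
    set t := eval ![u₀, v₀] (C a * X 0 ^ 2 + C b * (X 0 * X 1) + C c * X 1 ^ 2) with ht
    simp at hs ht
    have hu : 2 * (s * a - t * d) * u₀ + (s * b - t * e) * v₀ = 0 := by
      rw [hs, ht]
      linear_combination v₀ / 2 * hJ
    have hv : (s * b - t * e) * u₀ + 2 * (s * c - t * f) * v₀ = 0 := by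
      rw [hs, ht]
      linear_combination -u₀ / 2 * hJ
    obtain ⟨k, hA, hB, hC⟩ : ∃ k : ℂ, s * a - t * d = k * v₀ ^ 2 ∧
        s * b - t * e = -2 * k * (u₀ * v₀) ∧ s * c - t * f = k * u₀ ^ 2 := by
      by_cases h0 : u₀ = 0
      · have hv0 : v₀ ≠ 0 := fun h => hp ⟨h0, h⟩
        subst h0
        refine ⟨(s * a - t * d) / v₀ ^ 2, by field_simp, ?_, ?_⟩
        · simpa [hv0] using hu
        · simpa [hv0] using hv
      · have hB : s * b - t * e = -2 * (s * c - t * f) * v₀ / u₀ := by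
          rw [eq_div_iff h0]
          linear_combination hv
        refine ⟨(s * c - t * f) / u₀ ^ 2, ?_, ?_, by field_simp⟩
        · rw [hB] at hu
          field_simp at hu ⊢
          linear_combination hu / 2
        · rw [hB]
          field_simp
    refine ⟨k, ?_⟩
    have hA' := congrArg (C (σ := Fin 2)) hA
    have hB' := congrArg (C (σ := Fin 2)) hB
    have hC' := congrArg (C (σ := Fin 2)) hC
    simp only [map_sub, map_mul, map_pow, map_neg, map_ofNat] at hA' hB' hC'
    linear_combination X 0 ^ 2 * hA' + X 0 * X 1 * hB' + X 1 ^ 2 * hC'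
end

section
/- Let A, B, C ∈ ℂ[u,v] be homogeneous polynomials of degree 2. Then the three binary quadratic forms J(A,B), J(A,C), J(B,C) are linearly dependent over ℂ if and only if A, B, C are linearly dependent over ℂ. -/
open MvPolynomial

/-- The binary quadratic form `w₀ u² + w₁ u v + w₂ v²` with coefficient vector `w`. -/
noncomputable def quadForm : (Fin 3 → ℂ) →ₗ[ℂ] MvPolynomial (Fin 2) ℂ :=
  Fintype.linearCombination ℂ ![X 0 ^ 2, X 0 * X 1, X 1 ^ 2]

lemma quadForm_apply (w : Fin 3 → ℂ) :
    quadForm w = C (w 0) * X 0 ^ 2 + C (w 1) * (X 0 * X 1) + C (w 2) * X 1 ^ 2 := by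
  simp [quadForm, Fintype.linearCombination_apply, Fin.sum_univ_three, smul_eq_C_mul]

lemma quadForm_injective : Function.Injective quadForm := by
  rw [← LinearMap.ker_eq_bot, LinearMap.ker_eq_bot']
  intro w hw
  rw [quadForm_apply] at hw
  have h0 := congrArg (eval ![(1 : ℂ), 0]) hw
  have h2 := congrArg (eval ![(0 : ℂ), 1]) hw
  have h1 := congrArg (eval ![(1 : ℂ), 1]) hw
  simp at h0 h1 h2
  ext i
  fin_cases i <;> simp_all

lemma exists_quadForm_eq {A : MvPolynomial (Fin 2) ℂ} (hA : A.IsHomogeneous 2) :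
    ∃ w, quadForm w = A := by
  suffices A ∈ LinearMap.range quadForm from this
  rw [A.as_sum]
  refine Submodule.sum_mem _ fun d hd => ?_
  have hdeg : d 0 + d 1 = 2 := by
    have h := hA (mem_support_iff.1 hd)
    simpa [Finsupp.weight_apply, Finsupp.sum_fintype, Fin.sum_univ_two] using h
  rw [monomial_eq, Finsupp.prod_fintype _ _ (by simp), Fin.prod_univ_two]
  have h3 : d 0 = 0 ∧ d 1 = 2 ∨ d 0 = 1 ∧ d 1 = 1 ∨ d 0 = 2 ∧ d 1 = 0 := by omega
  rcases h3 with ⟨h, h'⟩ | ⟨h, h'⟩ | ⟨h, h'⟩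
  · exact ⟨![0, 0, coeff d A], by simp [quadForm_apply, h, h']⟩
  · exact ⟨![0, coeff d A, 0], by simp [quadForm_apply, h, h']⟩
  · exact ⟨![coeff d A, 0, 0], by simp [quadForm_apply, h, h']⟩

lemma jacob_quadForm (x y : Fin 3 → ℂ) :
    jacob (quadForm x) (quadForm y) =
      quadForm ![2 * (x 0 * y 1 - x 1 * y 0), 4 * (x 0 * y 2 - x 2 * y 0),
        2 * (x 1 * y 2 - x 2 * y 1)] := by
  have h2 : (C 2 : MvPolynomial (Fin 2) ℂ) = 2 := map_ofNat C 2
  have h4 : (C 4 : MvPolynomial (Fin 2) ℂ) = 4 := map_ofNat C 4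
  simp [jacob, quadForm_apply, pderiv_X, Derivation.leibniz_pow, h2, h4]
  ring

lemma linearIndependent_quadForm_iff (x y z : Fin 3 → ℂ) :
    LinearIndependent ℂ ![quadForm x, quadForm y, quadForm z] ↔
      (Matrix.of ![x, y, z]).det ≠ 0 := by
  have h : ![quadForm x, quadForm y, quadForm z] = quadForm ∘ ![x, y, z] := by
    ext1 i
    fin_cases i <;> rfl
  rw [h, LinearMap.linearIndependent_iff _ (LinearMap.ker_eq_bot.2 quadForm_injective),
    ← isUnit_iff_ne_zero, ← Matrix.isUnit_iff_isUnit_det,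
    ← Matrix.linearIndependent_rows_iff_isUnit]
  rfl

/-- For binary quadratic forms `A, B, C`, the Jacobians `J(A,B), J(A,C), J(B,C)` are
linearly dependent over `ℂ` iff `A, B, C` are linearly dependent over `ℂ`. -/
theorem stmt7 (A B C : MvPolynomial (Fin 2) ℂ)
    (hA : A.IsHomogeneous 2) (hB : B.IsHomogeneous 2) (hC : C.IsHomogeneous 2) :
    ¬ LinearIndependent ℂ ![jacob A B, jacob A C, jacob B C] ↔
      ¬ LinearIndependent ℂ ![A, B, C] := by
  obtain ⟨x, rfl⟩ := exists_quadForm_eq hA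
  obtain ⟨y, rfl⟩ := exists_quadForm_eq hB
  obtain ⟨z, rfl⟩ := exists_quadForm_eq hC
  simp only [jacob_quadForm, linearIndependent_quadForm_iff, not_not]
  have key : (Matrix.of ![![2 * (x 0 * y 1 - x 1 * y 0), 4 * (x 0 * y 2 - x 2 * y 0),
        2 * (x 1 * y 2 - x 2 * y 1)],
      ![2 * (x 0 * z 1 - x 1 * z 0), 4 * (x 0 * z 2 - x 2 * z 0),
        2 * (x 1 * z 2 - x 2 * z 1)],
      ![2 * (y 0 * z 1 - y 1 * z 0), 4 * (y 0 * z 2 - y 2 * z 0),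
        2 * (y 1 * z 2 - y 2 * z 1)]]).det = 16 * (Matrix.of ![x, y, z]).det ^ 2 := by
    simp [Matrix.det_fin_three]
    ring
  simp [key]
end

section
/- Let M₁, M₂, M₃ ∈ GL₂(ℂ) be non-scalar matrices such that each M_i² is a scalar matrix (so each M_i induces an involution of ℙ¹(ℂ)). Suppose moreover that the product M₁M₂M₃ is non-scalar and (M₁M₂M₃)² is a scalar matrix (i.e., the composed Möbius transformation is again an involution). Then the three binary quadratic forms Q_{M₁}, Q_{M₂}, Q_{M₃} are linearly dependent over ℂ. -/
open MvPolynomial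

/-- For `M = [[a,b],[c,d]]`, the binary quadratic form `Q_M(u,v) = c·u² + (d-a)·uv - b·v²`
whose projective zeros are the fixed points of the Möbius transformation induced by `M`. -/
noncomputable def Qform (M : Matrix (Fin 2) (Fin 2) ℂ) : MvPolynomial (Fin 2) ℂ :=
  C (M 1 0) * X 0 ^ 2 + C (M 1 1 - M 0 0) * (X 0 * X 1) - C (M 0 1) * X 1 ^ 2

/-- A matrix is scalar if it is a scalar multiple of the identity. -/
def IsScalarMat (M : Matrix (Fin 2) (Fin 2) ℂ) : Prop :=
  ∃ c : ℂ, M = c • (1 : Matrix (Fin 2) (Fin 2) ℂ)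

/-- A non-scalar `2 × 2` matrix with scalar square has trace zero. -/
theorem trace_eq_zero_of_isScalarMat_sq {M : Matrix (Fin 2) (Fin 2) ℂ}
    (h : ¬ IsScalarMat M) (hs : IsScalarMat (M * M)) : M 0 0 + M 1 1 = 0 := by
  by_contra ht
  obtain ⟨c, hc⟩ := hs
  have h00 := congrFun (congrFun hc 0) 0
  have h01 := congrFun (congrFun hc 0) 1
  have h10 := congrFun (congrFun hc 1) 0
  have h11 := congrFun (congrFun hc 1) 1
  simp [Matrix.mul_apply, Fin.sum_univ_two] at h00 h01 h10 h11
  have e01 : M 0 1 = 0 := (mul_eq_zero.mp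
    (show (M 0 0 + M 1 1) * M 0 1 = 0 by linear_combination h01)).resolve_left ht
  have e10 : M 1 0 = 0 := (mul_eq_zero.mp
    (show (M 0 0 + M 1 1) * M 1 0 = 0 by linear_combination h10)).resolve_left ht
  have e11 : M 1 1 - M 0 0 = 0 := (mul_eq_zero.mp
    (show (M 0 0 + M 1 1) * (M 1 1 - M 0 0) = 0 by linear_combination h11 - h00)).resolve_left ht
  refine h ⟨M 0 0, ?_⟩
  ext i j
  fin_cases i <;> fin_cases j <;> simp [e01, e10, sub_eq_zero.mp e11]

/-- Three traceless `2 × 2` matrices whose product is traceless have linearly dependent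
fixed-point forms. -/
theorem not_linearIndependent_Qform_of_trace_eq_zero (A B D : Matrix (Fin 2) (Fin 2) ℂ)
    (hA : A 0 0 + A 1 1 = 0) (hB : B 0 0 + B 1 1 = 0) (hD : D 0 0 + D 1 1 = 0)
    (hP : (A * B * D) 0 0 + (A * B * D) 1 1 = 0) :
    ¬ LinearIndependent ℂ ![Qform A, Qform B, Qform D] := by
  have hA' := eq_neg_of_add_eq_zero_right hA
  have hB' := eq_neg_of_add_eq_zero_right hB
  have hD' := eq_neg_of_add_eq_zero_right hD
  have hdet : (!![A 0 0, A 0 1, A 1 0; B 0 0, B 0 1, B 1 0; D 0 0, D 0 1, D 1 0]).det = 0 := by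
    simp only [Matrix.mul_apply, Fin.sum_univ_two, hA', hB', hD'] at hP
    simp [Matrix.det_fin_three]
    linear_combination hP
  obtain ⟨v, hv, hv0⟩ := Matrix.exists_vecMul_eq_zero_iff.mpr hdet
  have ha := congrFun hv0 0
  have hb := congrFun hv0 1
  have hc := congrFun hv0 2
  simp [Matrix.vecMul, dotProduct, Fin.sum_univ_three] at ha hb hc
  rw [Fintype.not_linearIndependent_iff]
  refine ⟨v, ?_, Function.ne_iff.mp hv⟩
  have ha' := congrArg (C (σ := Fin 2)) ha
  have hb' := congrArg (C (σ := Fin 2)) hb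
  have hc' := congrArg (C (σ := Fin 2)) hc
  simp only [map_add, map_mul, map_zero] at ha' hb' hc'
  simp only [Fin.sum_univ_three, Matrix.cons_val, Qform, hA', hB', hD', smul_eq_C_mul, map_sub,
    map_neg]
  linear_combination X 0 ^ 2 * hc' - 2 * (X 0 * X 1) * ha' - X 1 ^ 2 * hb'

/-- If `M₁, M₂, M₃ ∈ GL₂(ℂ)` induce involutions of `ℙ¹` whose composition is again an
involution, then the fixed-point quadratic forms `Q_{M₁}, Q_{M₂}, Q_{M₃}` are linearly
dependent over `ℂ`. -/
theorem stmt8 (M₁ M₂ M₃ : GL (Fin 2) ℂ)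
    (h₁ : ¬ IsScalarMat (M₁ : Matrix (Fin 2) (Fin 2) ℂ))
    (h₂ : ¬ IsScalarMat (M₂ : Matrix (Fin 2) (Fin 2) ℂ))
    (h₃ : ¬ IsScalarMat (M₃ : Matrix (Fin 2) (Fin 2) ℂ))
    (hs₁ : IsScalarMat ((M₁ : Matrix (Fin 2) (Fin 2) ℂ) * (M₁ : Matrix (Fin 2) (Fin 2) ℂ)))
    (hs₂ : IsScalarMat ((M₂ : Matrix (Fin 2) (Fin 2) ℂ) * (M₂ : Matrix (Fin 2) (Fin 2) ℂ)))
    (hs₃ : IsScalarMat ((M₃ : Matrix (Fin 2) (Fin 2) ℂ) * (M₃ : Matrix (Fin 2) (Fin 2) ℂ)))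
    (hp : ¬ IsScalarMat ((M₁ * M₂ * M₃ : GL (Fin 2) ℂ) : Matrix (Fin 2) (Fin 2) ℂ))
    (hps : IsScalarMat (((M₁ * M₂ * M₃ : GL (Fin 2) ℂ) : Matrix (Fin 2) (Fin 2) ℂ) *
      ((M₁ * M₂ * M₃ : GL (Fin 2) ℂ) : Matrix (Fin 2) (Fin 2) ℂ))) :
    ¬ LinearIndependent ℂ
      ![Qform (M₁ : Matrix (Fin 2) (Fin 2) ℂ),
        Qform (M₂ : Matrix (Fin 2) (Fin 2) ℂ),
        Qform (M₃ : Matrix (Fin 2) (Fin 2) ℂ)] := by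
  exact not_linearIndependent_Qform_of_trace_eq_zero _ _ _
    (trace_eq_zero_of_isScalarMat_sq h₁ hs₁) (trace_eq_zero_of_isScalarMat_sq h₂ hs₂)
    (trace_eq_zero_of_isScalarMat_sq h₃ hs₃) (trace_eq_zero_of_isScalarMat_sq hp hps)
end

section
/- Let α, β, γ ∈ ℂ, let λ_{ij} ∈ ℂ for 0 ≤ i ≤ j ≤ 3, set q := Σ_{0≤i≤j≤3} λ_{ij}X_iX_j, and let P := αX₀X₂²X₃² + βX₀X₁²X₃² + γX₀X₁²X₂² + X₁X₂X₃·q ∈ ℂ[X₀,X₁,X₂,X₃]. Let c denote the cubic Cremona substitution c(X₀,X₁,X₂,X₃) := (X₁X₂X₃, X₀X₂X₃, X₀X₁X₃, X₀X₁X₂), and for 0 ≤ i < j ≤ 3 define λ̂_{ij} := λ_{hk}, where {h,k} is the complement of {i,j} in {0,1,2,3}. Then one has the polynomial identity P ∘ c = X₀³X₁²X₂²X₃² · [ λ₀₀(X₁X₂X₃)² + λ₁₁(X₀X₂X₃)² + λ₂₂(X₀X₁X₃)² + λ₃₃(X₀X₁X₂)² + X₀X₁X₂X₃·( αX₁² +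 βX₂² + γX₃² + Σ_{0≤i<j≤3} λ̂_{ij}X_iX_j ) ]. (Thus the Cremona transform of the Coble quintic is an Enriques-type sextic whose quadric part q̂ satisfies q̂(1,0,0,0) = 0.) -/
open MvPolynomial

/-- The cubic Cremona substitution
`c(X₀,X₁,X₂,X₃) = (X₁X₂X₃, X₀X₂X₃, X₀X₁X₃, X₀X₁X₂)` acting on polynomials. -/
noncomputable def cremona :
    MvPolynomial (Fin 4) ℂ →ₐ[ℂ] MvPolynomial (Fin 4) ℂ :=
  aeval ![X 1 * X 2 * X 3, X 0 * X 2 * X 3, X 0 * X 1 * X 3, X 0 * X 1 * X 2]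

/-- The Cremona transform of the Coble quintic
`P = αX₀X₂²X₃² + βX₀X₁²X₃² + γX₀X₁²X₂² + X₁X₂X₃·q` (with
`q = Σ_{i≤j} λ_{ij}X_iX_j`) equals `X₀³X₁²X₂²X₃²` times an Enriques-type sextic whose
quadric part has the complementary coefficients `λ̂_{ij} = λ_{hk}`,
`{h,k} = {0,1,2,3} ∖ {i,j}`. -/
theorem stmt13 (α β γ : ℂ) (lam : Fin 4 → Fin 4 → ℂ) :
    cremona
      (MvPolynomial.C α * (X 0 * X 2 ^ 2 * X 3 ^ 2) +
       MvPolynomial.C β * (X 0 * X 1 ^ 2 * X 3 ^ 2) +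
       MvPolynomial.C γ * (X 0 * X 1 ^ 2 * X 2 ^ 2) +
       X 1 * X 2 * X 3 *
         (∑ i : Fin 4, ∑ j : Fin 4,
           if i ≤ j then MvPolynomial.C (lam i j) * (X i * X j) else 0))
    = X 0 ^ 3 * X 1 ^ 2 * X 2 ^ 2 * X 3 ^ 2 *
      (MvPolynomial.C (lam 0 0) * (X 1 * X 2 * X 3) ^ 2 +
       MvPolynomial.C (lam 1 1) * (X 0 * X 2 * X 3) ^ 2 +
       MvPolynomial.C (lam 2 2) * (X 0 * X 1 * X 3) ^ 2 +
       MvPolynomial.C (lam 3 3) * (X 0 * X 1 * X 2) ^ 2 +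
       X 0 * X 1 * X 2 * X 3 *
         (MvPolynomial.C α * X 1 ^ 2 + MvPolynomial.C β * X 2 ^ 2 +
          MvPolynomial.C γ * X 3 ^ 2 +
          (MvPolynomial.C (lam 2 3) * (X 0 * X 1) +
           MvPolynomial.C (lam 1 3) * (X 0 * X 2) +
           MvPolynomial.C (lam 1 2) * (X 0 * X 3) +
           MvPolynomial.C (lam 0 3) * (X 1 * X 2) +
           MvPolynomial.C (lam 0 2) * (X 1 * X 3) +
           MvPolynomial.C (lam 0 1) * (X 2 * X 3)))) := by
  have h₀ : cremona (X 0) = X 1 * X 2 * X 3 := by simp [cremona]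
  have h₁ : cremona (X 1) = X 0 * X 2 * X 3 := by simp [cremona]
  have h₂ : cremona (X 2) = X 0 * X 1 * X 3 := by simp [cremona]
  have h₃ : cremona (X 3) = X 0 * X 1 * X 2 := by simp [cremona]
  have hC (a : ℂ) : cremona (C a) = C a := cremona.commutes a
  simp [Fin.sum_univ_four, h₀, h₁, h₂, h₃, hC]
  ring
end
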